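/- Let G = (V, E) be a graph, let A, B ⊆ V with A ∪ B = V and A ∩ B = {r}, and suppose that r is adjacent in G to every other vertex and that every vertex of A ∖ {r} is adjacent in G to every vertex of B ∖ {r}. Suppose u = u1 r u2 is a word over A representing the induced subgraph G[A] in which r occurs exactly once and every vertex of A ∖ {r} occurs either exactly once (in u1) or exactly twice (once in u1 and once in u2); similarly, suppose v = v1 r v2 is a word over B representing G[B] in which r occurs exactly once and every vertex of B ∖ {r} occurs either exactly once (in v1) or exactly twice (once in v1 and once in v2). Then the word w = u2^R v1 r u1^R v2, where x^R denotes the reversal of the word x, represents G. -/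

import Mathlib

/-- Two distinct letters `a` and `b` alternate in the word `w`: the subsequence of `w`
consisting of all occurrences of `a` and `b` has no two consecutive equal letters. -/
def Alternates {V : Type*} [DecidableEq V] (w : List V) (a b : V) : Prop :=
  (w.filter (fun x => decide (x = a ∨ x = b))).Chain' (· ≠ ·)

/-- The word `w` represents the graph `G`: every vertex occurs in `w`, and distinct
vertices are adjacent iff they alternate in `w`. -/
def Represents {V : Type*} [DecidableEq V] (G : SimpleGraph V) (w : List V) : Prop :=
  (∀ v : V, v ∈ w) ∧ ∀ a b : V, a ≠ b → (G.Adj a b ↔ Alternates w a b)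

/-- The word `w`, whose letters all lie in `S`, represents the induced subgraph `G[S]`. -/
def RepresentsOn {V : Type*} [DecidableEq V] (G : SimpleGraph V) (S : Set V)
    (w : List V) : Prop :=
  (∀ x ∈ w, x ∈ S) ∧ (∀ v ∈ S, v ∈ w) ∧
    ∀ a ∈ S, ∀ b ∈ S, a ≠ b → (G.Adj a b ↔ Alternates w a b)

theorem alternates_iff_isChain {V : Type*} [DecidableEq V] {w : List V} {a b : V} :
    Alternates w a b ↔ (w.filter (fun x => decide (x = a ∨ x = b))).IsChain (· ≠ ·) :=
  Iff.rfl

theorem alternates_comm {V : Type*} [DecidableEq V] {w : List V} {a b : V} :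
    Alternates w a b ↔ Alternates w b a := by
  simp only [Alternates, or_comm]

theorem alternates_reverse {V : Type*} [DecidableEq V] {w : List V} {a b : V} :
    Alternates w.reverse a b ↔ Alternates w a b := by
  simp only [alternates_iff_isChain, List.filter_reverse, List.isChain_reverse, ne_comm]

theorem filter_pair_of_notMem_right {V : Type*} [DecidableEq V] {l : List V} (a : V) {b : V}
    (hb : b ∉ l) :
    l.filter (fun x => decide (x = a ∨ x = b)) = List.replicate (l.count a) a := by
  rw [← List.filter_eq]
  refine List.filter_congr fun x hx => ?_
  have : x ≠ b := fun h => hb (h ▸ hx)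
  simp [this]

theorem filter_pair_of_notMem_left {V : Type*} [DecidableEq V] {l : List V} {a : V} (b : V)
    (ha : a ∉ l) :
    l.filter (fun x => decide (x = a ∨ x = b)) = List.replicate (l.count b) b := by
  simpa only [or_comm] using filter_pair_of_notMem_right b ha

theorem filter_pair_of_notMem {V : Type*} [DecidableEq V] {l : List V} {a b : V}
    (ha : a ∉ l) (hb : b ∉ l) :
    l.filter (fun x => decide (x = a ∨ x = b)) = [] := by
  rw [filter_pair_of_notMem_right a hb, List.count_eq_zero_of_not_mem ha, List.replicate_zero]

/-- Gluing word-representants of `G[A]` and `G[B]` along the common root `r`: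
if `u = u1 r u2` represents `G[A]` and `v = v1 r v2` represents `G[B]`, with `r`
occurring exactly once in each and every other vertex occurring either exactly once
(in the first part) or exactly twice (once in each part), then
`w = u2^R v1 r u1^R v2` represents `G`. -/
theorem glue_word_representants
    {V : Type*} [Fintype V] [DecidableEq V] (G : SimpleGraph V)
    (A B : Set V) (r : V)
    (hUnion : A ∪ B = Set.univ) (hInter : A ∩ B = {r})
    (hroot : ∀ v : V, v ≠ r → G.Adj r v)
    (hcross : ∀ a ∈ A, ∀ b ∈ B, a ≠ r → b ≠ r → G.Adj a b)
    (u1 u2 v1 v2 : List V)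
    (hu : RepresentsOn G A (u1 ++ r :: u2))
    (hur1 : r ∉ u1) (hur2 : r ∉ u2)
    (huocc : ∀ a ∈ A, a ≠ r →
      (u1.count a = 1 ∧ u2.count a = 0) ∨ (u1.count a = 1 ∧ u2.count a = 1))
    (hv : RepresentsOn G B (v1 ++ r :: v2))
    (hvr1 : r ∉ v1) (hvr2 : r ∉ v2)
    (hvocc : ∀ b ∈ B, b ≠ r →
      (v1.count b = 1 ∧ v2.count b = 0) ∨ (v1.count b = 1 ∧ v2.count b = 1)) :
    Represents G (u2.reverse ++ v1 ++ r :: (u1.reverse ++ v2)) := by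
  have hu1 : ∀ x ∈ u1, x ∈ A := fun x hx => hu.1 x (by simp [hx])
  have hu2 : ∀ x ∈ u2, x ∈ A := fun x hx => hu.1 x (by simp [hx])
  have hv1 : ∀ x ∈ v1, x ∈ B := fun x hx => hv.1 x (by simp [hx])
  have hv2 : ∀ x ∈ v2, x ∈ B := fun x hx => hv.1 x (by simp [hx])
  have hcover : ∀ x, x ∈ A ∨ x ∈ B := fun x => by
    rw [← Set.mem_union, hUnion]
    exact Set.mem_univ x
  have hdisj : ∀ x ∈ A, x ∈ B → x = r := fun x hA hB => by
    have : x ∈ A ∩ B := ⟨hA, hB⟩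
    simpa [hInter] using this
  have hAv : ∀ x ∈ A, x ≠ r → x ∉ v1 ∧ x ∉ v2 := fun x hA hx =>
    ⟨fun h => hx (hdisj x hA (hv1 x h)), fun h => hx (hdisj x hA (hv2 x h))⟩
  have hBu : ∀ x ∈ B, x ≠ r → x ∉ u1 ∧ x ∉ u2 := fun x hB hx =>
    ⟨fun h => hx (hdisj x (hu1 x h) hB), fun h => hx (hdisj x (hu2 x h) hB)⟩
  have hroot_alt : ∀ x, x ≠ r → Alternates (u2.reverse ++ v1 ++ r :: (u1.reverse ++ v2)) r x := by
    intro x hx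
    rcases hcover x with hA | hB
    · obtain ⟨h1, h2⟩ := hAv x hA hx
      rcases huocc x hA hx with ⟨c1, c2⟩ | ⟨c1, c2⟩ <;>
      simp [-Bool.decide_or, alternates_iff_isChain, filter_pair_of_notMem_left x hur1,
        filter_pair_of_notMem_left x hur2, filter_pair_of_notMem hvr1 h1,
        filter_pair_of_notMem hvr2 h2, c1, c2, hx, hx.symm]
    · obtain ⟨h1, h2⟩ := hBu x hB hx
      rcases hvocc x hB hx with ⟨c1, c2⟩ | ⟨c1, c2⟩ <;>
      simp [-Bool.decide_or, alternates_iff_isChain, filter_pair_of_notMem_left x hvr1,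
        filter_pair_of_notMem_left x hvr2, filter_pair_of_notMem hur1 h1,
        filter_pair_of_notMem hur2 h2, c1, c2, hx, hx.symm]
  have hcross_alt : ∀ a ∈ A, ∀ b ∈ B, a ≠ r → b ≠ r → a ≠ b →
      Alternates (u2.reverse ++ v1 ++ r :: (u1.reverse ++ v2)) a b := by
    intro a hA b hB ha hb hab
    obtain ⟨h1, h2⟩ := hAv a hA ha
    obtain ⟨h3, h4⟩ := hBu b hB hb
    rcases huocc a hA ha with ⟨c1, c2⟩ | ⟨c1, c2⟩ <;>
    rcases hvocc b hB hb with ⟨d1, d2⟩ | ⟨d1, d2⟩ <;>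
    simp [-Bool.decide_or, alternates_iff_isChain, filter_pair_of_notMem_left b h1,
      filter_pair_of_notMem_left b h2, filter_pair_of_notMem_right a h3,
      filter_pair_of_notMem_right a h4, c1, c2, d1, d2, ha.symm, hb.symm, hab, hab.symm]
  refine ⟨fun x => ?_, fun a b hab => ?_⟩
  · rcases hcover x with h | h
    · have := hu.2.1 x h
      simp only [List.mem_append, List.mem_cons, List.mem_reverse] at this ⊢
      tauto
    · have := hv.2.1 x h
      simp only [List.mem_append, List.mem_cons, List.mem_reverse] at this ⊢
      tauto
  by_cases ha : a = r
  · subst ha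
    exact iff_of_true (hroot b hab.symm) (hroot_alt b hab.symm)
  by_cases hb : b = r
  · subst hb
    exact iff_of_true (hroot a hab).symm (alternates_comm.1 (hroot_alt a hab))
  rcases hcover a with hA | hA <;> rcases hcover b with hB | hB
  · obtain ⟨h1, h2⟩ := hAv a hA ha
    obtain ⟨h3, h4⟩ := hAv b hB hb
    rw [hu.2.2 a hA b hB hab, ← alternates_reverse]
    simp [-Bool.decide_or, alternates_iff_isChain, filter_pair_of_notMem h1 h3,
      filter_pair_of_notMem h2 h4, Ne.symm ha, Ne.symm hb]
  · exact iff_of_true (hcross a hA b hB ha hb) (hcross_alt a hA b hB ha hb hab)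
  · exact iff_of_true (hcross b hB a hA hb ha).symm
      (alternates_comm.1 (hcross_alt b hB a hA hb ha hab.symm))
  · obtain ⟨h1, h2⟩ := hBu a hA ha
    obtain ⟨h3, h4⟩ := hBu b hB hb
    rw [hv.2.2 a hA b hB hab]
    simp [-Bool.decide_or, alternates_iff_isChain, filter_pair_of_notMem h1 h3,
      filter_pair_of_notMem h2 h4, Ne.symm ha, Ne.symm hb]
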